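/- Let C be a Clifford unitary on n qubits whose flow tableau F(C) has 0-th row (1|0|0), phase column ε = (ε₁,…,ε₂ₙ) ∈ ℤ₄^{2n}, and phaseless 2n×2n block F̃ = ((A,B),(C′,D)) over 𝔽₂ (n×n blocks A, B, C′, D). Then the flow tableau of C† has phaseless block F̃′ = ((Dᵀ,Bᵀ),((C′)ᵀ,Aᵀ)) and phase column ε′ = −F̃′·ε + 2s, where F̃′·ε is computed entrywise in ℤ₄ with the 𝔽₂-entries of F̃′ lifted to {0,1}, and where s ∈ 𝔽₂^{2n} has i-th entry f′ᵢ · strup(((B·Aᵀ, B·(C′)ᵀ),(D·Aᵀ, D·(C′)ᵀ))) · (f′ᵢ)ᵀ, with f′ᵢ the i-th row of F̃′ and strup(·) the strictly upper triangular part of a matrix (each entry of 2s lifted from 𝔽₂ to {0,2} ⊆ ℤ₄). -/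

import Mathlib

open Matrix

abbrev GG (n : ℕ) := ZMod 4 × (Fin n → ZMod 2) × (Fin n → ZMod 2)

def dotF2 {n : ℕ} (a b : Fin n → ZMod 2) : ZMod 2 := ∑ j, a j * b j

def lift24 (x : ZMod 2) : ZMod 4 := (x.val : ZMod 4)

def gop {n : ℕ} (p q : GG n) : GG n :=
  (p.1 + q.1 + 2 * lift24 (dotF2 p.2.2 q.2.1), p.2.1 + q.2.1, p.2.2 + q.2.2)

abbrev PMat (n : ℕ) := Matrix (Fin n → ZMod 2) (Fin n → ZMod 2) ℂ

noncomputable def PauliOp {n : ℕ} (ε : ZMod 4) (ξ ζ : Fin n → ZMod 2) : PMat n :=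
  fun u v => Complex.I ^ ε.val * (-1 : ℂ) ^ (dotF2 ζ v).val * (if u = v + ξ then 1 else 0)

def eVec {n : ℕ} (t : Fin n) : Fin n → ZMod 2 := fun j => if j = t then 1 else 0

/-- A Clifford unitary: a unitary matrix normalizing the Pauli group
(under right conjugation C† P C). -/
def IsCliffordUnitary {n : ℕ} (C : PMat n) : Prop :=
  C * Cᴴ = 1 ∧ Cᴴ * C = 1 ∧
  ∀ p : GG n, ∃ q : GG n, Cᴴ * PauliOp p.1 p.2.1 p.2.2 * C = PauliOp q.1 q.2.1 q.2.2

/-- The generators g₀ = iI, g_j = P(0,e_j,0) (1 ≤ j ≤ n), g_{n+j} = P(0,0,e_j). -/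
noncomputable def gens (n : ℕ) (i : Fin (2 * n + 1)) : PMat n :=
  if _h0 : i.val = 0 then Complex.I • (1 : PMat n)
  else if h1 : i.val ≤ n then PauliOp 0 (eVec ⟨i.val - 1, by have := i.isLt; omega⟩) 0
  else PauliOp 0 0 (eVec ⟨i.val - 1 - n, by have := i.isLt; omega⟩)

/-- M is the flow tableau of C: row i presents C† gᵢ C, i.e. ρ(C† gᵢ C) = Mᵢ. -/
def IsFlowTableau {n : ℕ} (C : PMat n) (M : Fin (2 * n + 1) → GG n) : Prop :=
  ∀ i, PauliOp (M i).1 (M i).2.1 (M i).2.2 = Cᴴ * gens n i * C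

/-- M is the Clifford tableau of C: row i presents C gᵢ C†, i.e. ρ(C gᵢ C†) = Mᵢ. -/
def IsCliffordTableau {n : ℕ} (C : PMat n) (M : Fin (2 * n + 1) → GG n) : Prop :=
  ∀ i, PauliOp (M i).1 (M i).2.1 (M i).2.2 = C * gens n i * Cᴴ

/-- Row index 1,…,2n of a tableau, indexed by Fin n ⊕ Fin n. -/
def rowIdx (n : ℕ) : Fin n ⊕ Fin n → Fin (2 * n + 1)
  | .inl j => ⟨j.val + 1, by have := j.isLt; omega⟩
  | .inr j => ⟨n + j.val + 1, by have := j.isLt; omega⟩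

/-- The phaseless 2n×2n block of a tableau over 𝔽₂: row i is (ξᵢ | ζᵢ). -/
def tabBlock {n : ℕ} (M : Fin (2 * n + 1) → GG n) :
    Matrix (Fin n ⊕ Fin n) (Fin n ⊕ Fin n) (ZMod 2) :=
  fun i => Sum.elim (M (rowIdx n i)).2.1 (M (rowIdx n i)).2.2

/-- Ω = ((0,I),(I,0)). -/
def Ωblk (n : ℕ) : Matrix (Fin n ⊕ Fin n) (Fin n ⊕ Fin n) (ZMod 2) :=
  Matrix.fromBlocks 0 1 1 0

/-- The i-th bit (1 ≤ i ≤ 2n) of the phaseless part of ϱ ∈ Gₙ. -/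
def bitOf {n : ℕ} (ϱ : GG n) (i : Fin (2 * n)) : ZMod 2 :=
  if h : i.val < n then ϱ.2.1 ⟨i.val, h⟩
  else ϱ.2.2 ⟨i.val - n, by have := i.isLt; omega⟩

/-- The vector–tableau product ϱ ⊛ M := (ϱ₀·ε₀|0|0) ⊛ m_{i₁} ⊛ ⋯ ⊛ m_{i_k}
over the indices i ≥ 1 with ϱᵢ = 1, in increasing order. -/
def starVecMul {n : ℕ} (ϱ : GG n) (M : Fin (2 * n + 1) → GG n) : GG n :=
  (((List.finRange (2 * n)).filter (fun i => decide (bitOf ϱ i = 1))).map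
    (fun i => M i.succ)).foldl gop (ϱ.1 * (M 0).1, 0, 0)

/-- The position 1,…,2n of a row/column index in Fin n ⊕ Fin n. -/
def sumIdx {n : ℕ} : Fin n ⊕ Fin n → ℕ := Sum.elim Fin.val (fun j => n + j.val)

/-- Strictly upper triangular part of a 2n×2n matrix over 𝔽₂. -/
def strup {n : ℕ} (A : Matrix (Fin n ⊕ Fin n) (Fin n ⊕ Fin n) (ZMod 2)) :
    Matrix (Fin n ⊕ Fin n) (Fin n ⊕ Fin n) (ZMod 2) :=
  fun i j => if sumIdx i < sumIdx j then A i j else 0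

theorem I_pow_val_add (a b : ZMod 4) :
    Complex.I ^ (a + b).val = Complex.I ^ a.val * Complex.I ^ b.val := by
  rw [ZMod.val_add, ← Complex.I_pow_eq_pow_mod, pow_add]

theorem neg_one_pow_val_add (a b : ZMod 2) :
    (-1 : ℂ) ^ (a + b).val = (-1) ^ a.val * (-1) ^ b.val := by
  rw [ZMod.val_add, ← neg_one_pow_eq_pow_mod_two, pow_add]

theorem I_pow_two_mul_lift24 (x : ZMod 2) :
    Complex.I ^ (2 * lift24 x).val = (-1) ^ x.val := by
  have h : (2 * lift24 x).val = 2 * x.val := by revert x; decide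
  rw [h, pow_mul, Complex.I_sq]

theorem I_pow_val_injective : Function.Injective fun a : ZMod 4 => Complex.I ^ a.val := by
  intro a b h
  have hI : (Complex.I : ℂ) ≠ 1 := fun h => by simpa using congrArg Complex.re h
  have hI' : (Complex.I : ℂ) ≠ -1 := fun h => by simpa using congrArg Complex.re h
  have h1 : Complex.I ^ (a - b).val = 1 := by
    have hb : Complex.I ^ b.val ≠ 0 := pow_ne_zero _ Complex.I_ne_zero
    apply mul_right_cancel₀ hb
    rw [← I_pow_val_add, sub_add_cancel, one_mul]
    exact h
  rw [← sub_eq_zero]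
  generalize a - b = c at h1
  fin_cases c
  · rfl
  · exact absurd (by simpa [ZMod.val] using h1) hI
  · exact absurd (show (Complex.I : ℂ) ^ 2 = 1 from h1) (by norm_num [Complex.I_sq])
  · exact absurd (show (Complex.I : ℂ) ^ 3 = 1 from h1)
      (by rw [Complex.I_pow_three]; exact fun h => hI' (by rw [← h, neg_neg]))

theorem neg_one_pow_val_injective :
    Function.Injective fun a : ZMod 2 => (-1 : ℂ) ^ a.val := by
  intro a b h
  have h' : Complex.I ^ (2 * lift24 a).val = Complex.I ^ (2 * lift24 b).val := by
    simpa only [I_pow_two_mul_lift24] using h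
  have h'' : 2 * lift24 a = 2 * lift24 b := I_pow_val_injective h'
  clear h h'
  revert a b
  decide

theorem two_mul_lift24_add (a b : ZMod 2) :
    2 * lift24 (a + b) = 2 * lift24 a + 2 * lift24 b := by
  revert a b; decide

theorem neg_two_mul_lift24 (a : ZMod 2) : -(2 * lift24 a) = 2 * lift24 a := by
  revert a; decide

theorem dotF2_add_left {n : ℕ} (a b c : Fin n → ZMod 2) :
    dotF2 (a + b) c = dotF2 a c + dotF2 b c := by
  simp [dotF2, add_mul, Finset.sum_add_distrib]

theorem dotF2_add_right {n : ℕ} (a b c : Fin n → ZMod 2) :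
    dotF2 a (b + c) = dotF2 a b + dotF2 a c := by
  simp [dotF2, mul_add, Finset.sum_add_distrib]

theorem dotF2_smul_smul {n : ℕ} (x y : ZMod 2) (a b : Fin n → ZMod 2) :
    dotF2 (x • a) (y • b) = x * dotF2 a b * y := by
  simp only [dotF2, Pi.smul_apply, smul_eq_mul, Finset.mul_sum, Finset.sum_mul]
  exact Finset.sum_congr rfl fun _ _ => by ring

@[simp] theorem dotF2_zero_left {n : ℕ} (a : Fin n → ZMod 2) : dotF2 0 a = 0 := by
  simp [dotF2]

@[simp] theorem dotF2_zero_right {n : ℕ} (a : Fin n → ZMod 2) : dotF2 a 0 = 0 := by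
  simp [dotF2]

@[simp] theorem dotF2_eVec_right {n : ℕ} (a : Fin n → ZMod 2) (j : Fin n) :
    dotF2 a (eVec j) = a j := by
  simp [dotF2, eVec]

theorem dotF2_sum_right {n : ℕ} (a : Fin n → ZMod 2) (l : List (Fin n → ZMod 2)) :
    dotF2 a l.sum = (l.map (dotF2 a)).sum := by
  induction l with
  | nil => simp
  | cons b l ih => simp [dotF2_add_right, ih]

/-- The Pauli matrix presented by an element of `GG n`. -/
noncomputable def pauli {n : ℕ} (p : GG n) : PMat n := PauliOp p.1 p.2.1 p.2.2

theorem pauli_mul {n : ℕ} (p q : GG n) : pauli p * pauli q = pauli (gop p q) := by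
  ext u v
  rw [Matrix.mul_apply, Finset.sum_eq_single (v + q.2.1)]
  · simp only [pauli, PauliOp, gop, I_pow_val_add, I_pow_two_mul_lift24, dotF2_add_left,
      dotF2_add_right, neg_one_pow_val_add, if_true, add_assoc, add_comm q.2.1 p.2.1]
    ring
  · intro w _ hw
    simp [pauli, PauliOp, hw]
  · simp

theorem pauli_injective {n : ℕ} : Function.Injective (pauli (n := n)) := by
  rintro ⟨ε, ξ, ζ⟩ ⟨ε', ξ', ζ'⟩ h
  have hξ : ξ = ξ' := by
    by_contra hne
    have := congrFun (congrFun h ξ) 0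
    simp [pauli, PauliOp, hne] at this
  subst hξ
  have hε : ε = ε' := by
    have := congrFun (congrFun h ξ) 0
    simp only [pauli, PauliOp, dotF2_zero_right, zero_add, if_true, ZMod.val_zero, pow_zero,
      mul_one] at this
    exact I_pow_val_injective this
  subst hε
  have hζ : ζ = ζ' := by
    funext j
    have := congrFun (congrFun h (eVec j + ξ)) (eVec j)
    simp only [pauli, PauliOp, dotF2_eVec_right, if_true, mul_one] at this
    exact neg_one_pow_val_injective (mul_left_cancel₀ (pow_ne_zero _ Complex.I_ne_zero) this)
  rw [hζ]

@[simp] theorem pauli_zero {n : ℕ} : pauli (0 : GG n) = 1 := by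
  ext u v
  simp [pauli, PauliOp, Matrix.one_apply]

theorem pauli_phase {n : ℕ} (ε : ZMod 4) :
    pauli ((ε, 0, 0) : GG n) = (Complex.I ^ ε.val) • (1 : PMat n) := by
  ext u v
  simp [pauli, PauliOp, Matrix.one_apply]

/-- The element `p` of `GG n` raised to a power in `{0, 1}`. -/
def bitPow {n : ℕ} (c : ZMod 2) (p : GG n) : GG n := (lift24 c * p.1, c • p.2.1, c • p.2.2)

@[simp] theorem bitPow_zero {n : ℕ} (p : GG n) : bitPow 0 p = 0 := by
  simp [bitPow, lift24]

@[simp] theorem bitPow_one {n : ℕ} (p : GG n) : bitPow 1 p = p := by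
  simp [bitPow, lift24, ZMod.val_one]

/-- Ordered product of Pauli matrices along a list sorted by `s`. -/
theorem prod_map_pauli {n : ℕ} {ι : Type*} (s : ι → ℕ) (r : ι → GG n) (l : List ι)
    (hl : l.Pairwise fun j k => s j < s k) :
    (l.map fun j => pauli (r j)).prod =
      pauli ((l.map fun j => (r j).1).sum + 2 * lift24 (l.map fun j =>
          (l.map fun k => if s j < s k then dotF2 (r j).2.2 (r k).2.1 else 0).sum).sum,
        (l.map fun j => (r j).2.1).sum, (l.map fun j => (r j).2.2).sum) := by
  induction l with
  | nil => exact pauli_zero.symm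
  | cons a l ih =>
    rw [List.pairwise_cons] at hl
    have h1 : (l.map fun k => if s a < s k then dotF2 (r a).2.2 (r k).2.1 else 0) =
        l.map fun k => dotF2 (r a).2.2 (r k).2.1 :=
      List.map_congr_left fun k hk => if_pos (hl.1 k hk)
    have h2 : (l.map fun j => (if s j < s a then dotF2 (r j).2.2 (r a).2.1 else 0) +
          (l.map fun k => if s j < s k then dotF2 (r j).2.2 (r k).2.1 else 0).sum) =
        l.map fun j =>
          (l.map fun k => if s j < s k then dotF2 (r j).2.2 (r k).2.1 else 0).sum :=
      List.map_congr_left fun k hk => by rw [if_neg (hl.1 k hk).not_gt, zero_add]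
    have h3 : dotF2 (r a).2.2 (l.map fun j => (r j).2.1).sum =
        (l.map fun k => dotF2 (r a).2.2 (r k).2.1).sum := by
      rw [dotF2_sum_right, List.map_map]; rfl
    rw [List.map_cons, List.prod_cons, ih hl.2, pauli_mul]
    simp only [gop, List.map_cons, List.sum_cons, h1, h2, h3, lt_irrefl, if_false, zero_add,
      two_mul_lift24_add]
    congr 2
    ring

/-- All row indices in increasing order. -/
def rowList (n : ℕ) : List (Fin n ⊕ Fin n) :=
  (List.finRange n).map Sum.inl ++ (List.finRange n).map Sum.inr

theorem rowList_pairwise (n : ℕ) :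
    (rowList n).Pairwise fun j k => sumIdx j < sumIdx k := by
  rw [rowList, List.pairwise_append, List.pairwise_map, List.pairwise_map]
  refine ⟨(List.pairwise_lt_finRange n).imp fun h => h,
    (List.pairwise_lt_finRange n).imp fun h => by simpa [sumIdx] using h, ?_⟩
  simp only [List.mem_map, List.mem_finRange, true_and]
  rintro _ ⟨a, rfl⟩ _ ⟨b, rfl⟩
  simp only [sumIdx, Sum.elim_inl, Sum.elim_inr]
  omega

theorem sum_map_rowList {n : ℕ} {R : Type*} [AddCommMonoid R] (f : Fin n ⊕ Fin n → R) :
    ((rowList n).map f).sum = ∑ j, f j := by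
  simp [rowList, Fintype.sum_sum_type, List.sum_append, Fin.sum_univ_def, Function.comp_def]

/-- The generators of the Pauli group, as elements of `GG n`. -/
def genRow {n : ℕ} : Fin n ⊕ Fin n → GG n
  | .inl j => (0, eVec j, 0)
  | .inr j => (0, 0, eVec j)

theorem gens_rowIdx {n : ℕ} (i : Fin n ⊕ Fin n) : gens n (rowIdx n i) = pauli (genRow i) := by
  rcases i with j | j
  · have h : (j : ℕ) + 1 ≤ n := j.isLt
    simp [gens, rowIdx, genRow, pauli, h]
  · have h : ¬ n + (j : ℕ) + 1 ≤ n := by omega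
    have h' : n + (j : ℕ) - n = j := by omega
    simp [gens, rowIdx, genRow, pauli, h, h']

theorem prod_map_bitPow {n : ℕ} (c : Fin n ⊕ Fin n → ZMod 2) (r : Fin n ⊕ Fin n → GG n) :
    ((rowList n).map fun j => pauli (bitPow (c j) (r j))).prod =
      pauli (∑ j, lift24 (c j) * (r j).1 + 2 * lift24 (∑ j, ∑ k, c j *
          (if sumIdx j < sumIdx k then dotF2 (r j).2.2 (r k).2.1 else 0) * c k),
        ∑ j, c j • (r j).2.1, ∑ j, c j • (r j).2.2) := by
  rw [prod_map_pauli sumIdx _ _ (rowList_pairwise n)]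
  simp only [sum_map_rowList, bitPow, dotF2_smul_smul, mul_ite, ite_mul, mul_zero, zero_mul]

theorem prod_map_bitPow_genRow {n : ℕ} (ξ ζ : Fin n → ZMod 2) :
    ((rowList n).map fun j => pauli (bitPow (Sum.elim ξ ζ j) (genRow j))).prod =
      pauli (0, ξ, ζ) := by
  rw [prod_map_bitPow]
  have h : ∀ j k : Fin n ⊕ Fin n,
      (if sumIdx j < sumIdx k then dotF2 (genRow j).2.2 (genRow k).2.1 else 0) = 0 := by
    rintro (j | j) (k | k)
    · simp [genRow]
    · simp [genRow]
    · rw [if_neg]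
      simp only [sumIdx, Sum.elim_inl, Sum.elim_inr]
      omega
    · simp [genRow]
  congr 2
  · simp only [h]
    simp [Fintype.sum_sum_type, genRow, lift24]
  · congr 1 <;> funext t <;> simp [Fintype.sum_sum_type, genRow, eVec]

theorem conj_list_prod {n : ℕ} {C : PMat n} (h1 : C * Cᴴ = 1) (h2 : Cᴴ * C = 1)
    (l : List (PMat n)) : Cᴴ * l.prod * C = (l.map fun Q => Cᴴ * Q * C).prod := by
  induction l with
  | nil => simp [h2]
  | cons a l ih =>
    rw [List.prod_cons, List.map_cons, List.prod_cons, ← ih]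
    calc Cᴴ * (a * l.prod) * C = Cᴴ * a * 1 * l.prod * C := by simp only [mul_one, mul_assoc]
      _ = _ := by rw [← h1]; simp only [mul_assoc]

/-- Conjugation of an arbitrary Pauli matrix, computed from the flow tableau. -/
theorem conj_pauli {n : ℕ} {C : PMat n} (h1 : C * Cᴴ = 1) (h2 : Cᴴ * C = 1)
    {r : Fin n ⊕ Fin n → GG n} (hr : ∀ j, pauli (r j) = Cᴴ * pauli (genRow j) * C)
    (p : GG n) :
    Cᴴ * pauli p * C = pauli (p.1 + (∑ j, lift24 (Sum.elim p.2.1 p.2.2 j) * (r j).1 +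
        2 * lift24 (∑ j, ∑ k, Sum.elim p.2.1 p.2.2 j *
          (if sumIdx j < sumIdx k then dotF2 (r j).2.2 (r k).2.1 else 0) *
            Sum.elim p.2.1 p.2.2 k)),
        ∑ j, Sum.elim p.2.1 p.2.2 j • (r j).2.1, ∑ j, Sum.elim p.2.1 p.2.2 j • (r j).2.2) := by
  obtain ⟨ε, ξ, ζ⟩ := p
  have hbit : ∀ (c : ZMod 2) (j),
      Cᴴ * pauli (bitPow c (genRow j)) * C = pauli (bitPow c (r j)) := by
    intro c j
    obtain rfl | rfl : c = 0 ∨ c = 1 := by revert c; decide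
    · simp [h2]
    · simp [hr]
  have hprod : Cᴴ * pauli ((0, ξ, ζ) : GG n) * C =
      ((rowList n).map fun j => pauli (bitPow (Sum.elim ξ ζ j) (r j))).prod := by
    rw [← prod_map_bitPow_genRow, conj_list_prod h1 h2, List.map_map]
    simp only [Function.comp_def, hbit]
  have hsplit : ∀ q : GG n, pauli (ε + q.1, q.2) = (Complex.I ^ ε.val) • pauli q := by
    intro q
    have : ((ε + q.1, q.2) : GG n) = gop (ε, 0, 0) q := by simp [gop, lift24]
    rw [this, ← pauli_mul, pauli_phase, smul_mul_assoc, one_mul]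
  rw [hsplit (_, _), ← prod_map_bitPow, ← hprod]
  have := hsplit (0, ξ, ζ)
  rw [add_zero] at this
  rw [this, mul_smul_comm, smul_mul_assoc]

/-- Conjugation by a unitary preserves the symplectic form. -/
theorem conj_symplectic {n : ℕ} {C : PMat n} (h1 : C * Cᴴ = 1) {p q p' q' : GG n}
    (hp : pauli p' = Cᴴ * pauli p * C) (hq : pauli q' = Cᴴ * pauli q * C) :
    dotF2 p'.2.2 q'.2.1 + dotF2 q'.2.2 p'.2.1 = dotF2 p.2.2 q.2.1 + dotF2 q.2.2 p.2.1 := by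
  have hmul : ∀ X Y : PMat n, Cᴴ * X * C * (Cᴴ * Y * C) = Cᴴ * (X * Y) * C := by
    intro X Y
    calc Cᴴ * X * C * (Cᴴ * Y * C) = Cᴴ * X * (C * Cᴴ) * Y * C := by simp only [mul_assoc]
      _ = _ := by rw [h1]; simp only [mul_one, mul_assoc]
  have hcomm : ∀ a b : GG n, pauli a * pauli b =
      ((-1 : ℂ) ^ (dotF2 a.2.2 b.2.1 + dotF2 b.2.2 a.2.1).val) • (pauli b * pauli a) := by
    intro a b
    rw [← I_pow_two_mul_lift24, ← one_mul (pauli b * pauli a), ← smul_mul_assoc, ← pauli_phase,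
      pauli_mul, pauli_mul, pauli_mul]
    congr 1
    have h : ∀ x y : ZMod 2, 2 * lift24 x = 2 * lift24 (x + y) + 2 * lift24 y := by decide
    simp only [gop, dotF2_zero_left, zero_add, add_comm b.2.1, add_comm b.2.2]
    congr 1
    rw [h _ (dotF2 b.2.2 a.2.1)]
    simp only [lift24, ZMod.val_zero, Nat.cast_zero, mul_zero]
    ring
  have h := hcomm p' q'
  rw [hp, hq, hmul, hmul, hcomm p q, mul_smul_comm, smul_mul_assoc, ← hmul (pauli q) (pauli p), ← hp,
    ← hq, pauli_mul] at h
  apply neg_one_pow_val_injective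
  have h0 := congrFun (congrFun h (gop q' p').2.1) 0
  simp only [Matrix.smul_apply, smul_eq_mul] at h0
  refine (mul_right_cancel₀ ?_ h0).symm
  simp [pauli, PauliOp]

/-- if the flow tableau of C has 0-th row (1|0|0), phase column ε and
phaseless block F̃ = ((A,B),(C₂,D)), then the flow tableau of C† has phaseless block
F̃′ = ((Dᵀ,Bᵀ),(C₂ᵀ,Aᵀ)) and phase column ε′ = −F̃′·ε + 2s, with
sᵢ = f′ᵢ · strup(((BAᵀ,BC₂ᵀ),(DAᵀ,DC₂ᵀ))) · (f′ᵢ)ᵀ. -/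
theorem stmt18 (n : ℕ) (hn : 1 ≤ n) (C : PMat n) (hC : IsCliffordUnitary C)
    (M M' : Fin (2 * n + 1) → GG n)
    (hM : IsFlowTableau C M) (hM' : IsFlowTableau Cᴴ M')
    (h0 : M 0 = (1, 0, 0))
    (A B C₂ D : Matrix (Fin n) (Fin n) (ZMod 2))
    (hblk : tabBlock M = Matrix.fromBlocks A B C₂ D) :
    tabBlock M' = Matrix.fromBlocks Dᵀ Bᵀ C₂ᵀ Aᵀ ∧
    ∀ i : Fin n ⊕ Fin n,
      (M' (rowIdx n i)).1 =
        -(∑ j : Fin n ⊕ Fin n,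
            lift24 (Matrix.fromBlocks Dᵀ Bᵀ C₂ᵀ Aᵀ i j) * (M (rowIdx n j)).1) +
        2 * lift24 (∑ j : Fin n ⊕ Fin n, ∑ k : Fin n ⊕ Fin n,
            Matrix.fromBlocks Dᵀ Bᵀ C₂ᵀ Aᵀ i j *
            strup (Matrix.fromBlocks (B * Aᵀ) (B * C₂ᵀ) (D * Aᵀ) (D * C₂ᵀ)) j k *
            Matrix.fromBlocks Dᵀ Bᵀ C₂ᵀ Aᵀ i k) := by
  obtain ⟨h1, h2, -⟩ := hC
  set G := Matrix.fromBlocks Dᵀ Bᵀ C₂ᵀ Aᵀ with hG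
  set r : Fin n ⊕ Fin n → GG n := fun j => M (rowIdx n j) with hr
  have hrow : ∀ j, pauli (r j) = Cᴴ * pauli (genRow j) * C := fun j => by
    rw [← gens_rowIdx]; exact hM _
  have hX : ∀ j, (r j).2.1 = Sum.elim (fun a => A a) (fun a => C₂ a) j := by
    rintro (j | j) <;> funext t
    · exact congrFun (congrFun hblk (.inl j)) (.inl t)
    · exact congrFun (congrFun hblk (.inr j)) (.inl t)
  have hZ : ∀ j, (r j).2.2 = Sum.elim (fun a => B a) (fun a => D a) j := by
    rintro (j | j) <;> funext t
    · exact congrFun (congrFun hblk (.inl j)) (.inr t)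
    · exact congrFun (congrFun hblk (.inr j)) (.inr t)
  have hFG : tabBlock M * G = 1 := by
    have hs := fun j k => conj_symplectic h1 (hrow j) (hrow k)
    rw [hblk, hG]
    ext i j
    have hij := hs i j.swap
    rw [hX, hX, hZ, hZ] at hij
    rcases i with i | i <;> rcases j with j | j <;>
      simp only [genRow, Sum.swap_inl, Sum.swap_inr, Sum.elim_inl, Sum.elim_inr,
        dotF2_zero_right, dotF2_eVec_right, add_zero, zero_add] at hij <;>
      simpa [dotF2, eVec, Matrix.mul_apply, Matrix.one_apply, mul_comm, add_comm, eq_comm]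
        using hij.symm
  have hinv : ∀ i, genRow i = _ := fun i => pauli_injective <| by
    have hi : pauli (M' (rowIdx n i)) = C * pauli (genRow i) * Cᴴ := by
      have := hM' (rowIdx n i)
      rwa [Matrix.conjTranspose_conjTranspose, gens_rowIdx] at this
    rw [← conj_pauli h1 h2 hrow (M' (rowIdx n i)), hi]
    calc pauli (genRow i) = Cᴴ * C * pauli (genRow i) * (Cᴴ * C) := by simp [h2]
      _ = _ := by simp only [mul_assoc]
  have hGF : tabBlock M' * tabBlock M = 1 := by
    ext i j
    have hξ := congrArg (fun p : GG n => p.2.1) (hinv i)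
    have hζ := congrArg (fun p : GG n => p.2.2) (hinv i)
    dsimp only at hξ hζ
    rcases j with j | j
    · have := congrFun hξ j
      rw [Finset.sum_apply] at this
      rw [Matrix.mul_apply]
      refine this.symm.trans ?_
      rcases i with i | i <;> simp [genRow, eVec, Matrix.one_apply, eq_comm]
    · have := congrFun hζ j
      rw [Finset.sum_apply] at this
      rw [Matrix.mul_apply]
      refine this.symm.trans ?_
      rcases i with i | i <;> simp [genRow, eVec, Matrix.one_apply, eq_comm]
  have hblk' : tabBlock M' = G := left_inv_eq_right_inv hGF hFG
  refine ⟨hblk', fun i => ?_⟩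
  have hε := congrArg Prod.fst (hinv i)
  have hGi : Sum.elim (M' (rowIdx n i)).2.1 (M' (rowIdx n i)).2.2 = G i := congrFun hblk' i
  have hW : ∀ j k, (if sumIdx j < sumIdx k then dotF2 (r j).2.2 (r k).2.1 else 0) =
      strup (Matrix.fromBlocks (B * Aᵀ) (B * C₂ᵀ) (D * Aᵀ) (D * C₂ᵀ)) j k := by
    intro j k
    rw [strup, hX, hZ]
    congr 1
    rcases j with j | j <;> rcases k with k | k <;>
      simp [dotF2, Matrix.mul_apply]
  have h0' : (genRow i).1 = 0 := by rcases i with i | i <;> rfl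
  simp only [hGi, hW, h0'] at hε
  rw [← neg_two_mul_lift24, ← neg_add, eq_neg_iff_add_eq_zero]
  exact hε.symm
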